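/- arXiv:2106.13350 — 2 statements merged into one kernel-verified Lean document; each statement's English description precedes it below -/
import Mathlib

section
/- A reference-dependent random choice rule {p_r}_{r∈X} has an IRA representation if and only if it has both an LRA representation and a CRA representation. -/
open Finset
open scoped Classical

namespace RDRAM

noncomputable section

variable {α : Type*} [Fintype α] [DecidableEq α]

/-- `x` is the `R`-maximum of `D`. -/
def IsMaxOf (R : α → α → Prop) (x : α) (D : Finset α) : Prop :=
  x ∈ D ∧ ∀ y ∈ D, R x y

/-- `R` is a linear order: complete, antisymmetric, transitive. -/
structure LinOrd (R : α → α → Prop) : Prop where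
  total : ∀ x y, R x y ∨ R y x
  antisymm : ∀ x y, R x y → R y x → x = y
  trans : ∀ x y z, R x y → R y z → R x z

/-- A reference-dependent random choice rule `p r x S`. -/
structure IsRandomChoiceRule (p : α → α → Finset α → ℝ) : Prop where
  nonneg : ∀ r x S, 0 ≤ p r x S
  support : ∀ r x (S : Finset α), S.Nonempty → r ∈ S → 0 < p r x S → x ∈ S
  sum_one : ∀ r (S : Finset α), S.Nonempty → r ∈ S → ∑ x ∈ S, p r x S = 1

/-- A stochastic choice rule `q x S` (no reference). -/
structure IsStochasticChoiceRule (q : α → Finset α → ℝ) : Prop where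
  nonneg : ∀ x S, 0 ≤ q x S
  support : ∀ x (S : Finset α), S.Nonempty → 0 < q x S → x ∈ S
  sum_one : ∀ S : Finset α, S.Nonempty → ∑ x ∈ S, q x S = 1

/-- A random attention rule `μ D S` for reference `r`. -/
structure IsAttentionRule (r : α) (μ : Finset α → Finset α → ℝ) : Prop where
  nonneg : ∀ D S, 0 ≤ μ D S
  support : ∀ (S D : Finset α), S.Nonempty → r ∈ S → 0 < μ D S → r ∈ D ∧ D ⊆ S
  sum_one : ∀ (S : Finset α), S.Nonempty → r ∈ S → ∑ D ∈ S.powerset, μ D S = 1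

/-- Full support: every admissible consideration set has positive probability. -/
def FullSupport (r : α) (μ : Finset α → Finset α → ℝ) : Prop :=
  ∀ (S D : Finset α), S.Nonempty → r ∈ S → r ∈ D → D ⊆ S → 0 < μ D S

/-- `(R, μ)` is an RD-RAM representation of `p`. -/
def IsRDRAMRep (p : α → α → Finset α → ℝ) (R : α → α → Prop)
    (μ : α → Finset α → Finset α → ℝ) : Prop :=
  LinOrd R ∧ (∀ r, IsAttentionRule r (μ r) ∧ FullSupport r (μ r)) ∧
    ∀ r (S : Finset α), S.Nonempty → r ∈ S → ∀ x ∈ S,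
      p r x S = ∑ D ∈ S.powerset.filter (fun D => r ∈ D ∧ IsMaxOf R x D), μ r D S

/-- Independent Random Attention representation of an attention rule. -/
def HasIRA (r : α) (μ : Finset α → Finset α → ℝ) : Prop :=
  ∃ γ : α → ℝ, γ r = 1 ∧ (∀ x, x ≠ r → 0 < γ x ∧ γ x < 1) ∧
    ∀ (S : Finset α), S.Nonempty → r ∈ S → ∀ D : Finset α, r ∈ D → D ⊆ S →
      μ D S = (∏ x ∈ D, γ x) * ∏ y ∈ S \ D, (1 - γ y)

/-- Luce Random Attention representation of an attention rule. -/
def HasLRA (r : α) (μ : Finset α → Finset α → ℝ) : Prop :=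
  ∃ π : Finset α → ℝ, (∀ D : Finset α, r ∈ D → 0 < π D) ∧
    (∑ D ∈ (univ : Finset α).powerset.filter (fun D => r ∈ D), π D = 1) ∧
    ∀ (S : Finset α), S.Nonempty → r ∈ S → ∀ D : Finset α, r ∈ D → D ⊆ S →
      μ D S = π D / ∑ D' ∈ S.powerset.filter (fun D' => r ∈ D'), π D'

/-- Constant Random Attention representation of an attention rule. -/
def HasCRA (r : α) (μ : Finset α → Finset α → ℝ) : Prop :=
  ∃ π : Finset α → ℝ, (∀ D : Finset α, r ∈ D → 0 < π D) ∧
    (∑ D ∈ (univ : Finset α).powerset.filter (fun D => r ∈ D), π D = 1) ∧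
    ∀ (S : Finset α), S.Nonempty → r ∈ S → ∀ D : Finset α, r ∈ D → D ⊆ S →
      μ D S = ∑ D' ∈ (univ : Finset α).powerset.filter (fun D' => D' ∩ S = D), π D'

/-- `p` has an IRA representation. -/
def HasIRARep (p : α → α → Finset α → ℝ) : Prop :=
  ∃ (R : α → α → Prop) (μ : α → Finset α → Finset α → ℝ),
    IsRDRAMRep p R μ ∧ ∀ r, HasIRA r (μ r)

/-- `p` has an LRA representation. -/
def HasLRARep (p : α → α → Finset α → ℝ) : Prop :=
  ∃ (R : α → α → Prop) (μ : α → Finset α → Finset α → ℝ),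
    IsRDRAMRep p R μ ∧ ∀ r, HasLRA r (μ r)

/-- `p` has a CRA representation. -/
def HasCRARep (p : α → α → Finset α → ℝ) : Prop :=
  ∃ (R : α → α → Prop) (μ : α → Finset α → Finset α → ℝ),
    IsRDRAMRep p R μ ∧ ∀ r, HasCRA r (μ r)

/-- No-Cycle Condition. -/
def NCC (p : α → α → Finset α → ℝ) : Prop :=
  ∀ (n : ℕ) (x : Fin (n + 1) → α) (Sq : Fin (n + 1) → Finset α),
    (∀ i, (Sq i).Nonempty ∧ x i ∈ Sq i) →
    (∀ i : Fin n, x i.succ ∈ Sq i.castSucc ∧ x i.succ ≠ x i.castSucc ∧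
      0 < p (x i.castSucc) (x i.succ) (Sq i.castSucc)) →
    x 0 ∈ Sq (Fin.last n) → x 0 ≠ x (Fin.last n) →
    p (x (Fin.last n)) (x 0) (Sq (Fin.last n)) = 0

/-- Status Quo Asymmetry. -/
def SQA (p : α → α → Finset α → ℝ) : Prop :=
  ∀ x y : α, x ≠ y → ∀ S T : Finset α, x ∈ S → y ∈ S → x ∈ T → y ∈ T →
    p y x S = 0 → 0 < p x y T

/-- Nontrivial Reference Effect. -/
def NRE (p : α → α → Finset α → ℝ) : Prop :=
  ∀ x (S : Finset α), x ∈ S → 0 < p x x S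

/-- Irrelevance of Dominated Alternatives. -/
def IDA (p : α → α → Finset α → ℝ) : Prop :=
  ∀ r (S : Finset α), S.Nonempty → r ∈ S → ∀ x ∈ S, ∀ y ∈ S, y ≠ r → y ≠ x →
    (∃ T : Finset α, x ∈ T ∧ y ∈ T ∧ 0 < p y x T) →
    p r x S = p r x (S.erase y)

/-- Ratio Independence of Dominant Alternatives. -/
def RIDA (p : α → α → Finset α → ℝ) : Prop :=
  ∀ r (S : Finset α), S.Nonempty → r ∈ S → ∀ x ∈ S, x ≠ r →
    ∀ y ∈ S, y ≠ x → ∀ z ∈ S, z ≠ x →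
      p x x S = 1 → 0 < p r y S * p r z S →
      p r y S / p r z S = p r y (S.erase x) / p r z (S.erase x)

/-- `Pset p r`: the set of alternatives that dominate `r`. -/
def Pset (p : α → α → Finset α → ℝ) (r : α) : Finset α :=
  univ.filter (fun s => s ≠ r ∧ ∃ T : Finset α, r ∈ T ∧ s ∈ T ∧ 0 < p r s T)

/-- Odds against the reference alternative. -/
def odds (p : α → α → Finset α → ℝ) (r : α) (S : Finset α) : ℝ :=
  (1 - p r r S) / p r r S

/-- Decreasing Odds for the Reference Alternative. -/
def DORA (p : α → α → Finset α → ℝ) : Prop :=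
  ∀ r (S : Finset α), S.Nonempty → r ∈ S → ∀ (n : ℕ) (U : Fin n → Finset α),
    (∀ i, U i ⊆ Pset p r ∧ (S ∩ U i).Nonempty) →
    0 < ∑ I ∈ (univ : Finset (Fin n)).powerset,
      (-1 : ℝ) ^ I.card * odds p r (S \ I.biUnion U)

/-- Decreasing Propensity of Choice for the Reference Alternative. -/
def DPCRA (p : α → α → Finset α → ℝ) : Prop :=
  ∀ r (S : Finset α), S.Nonempty → r ∈ S → ∀ (n : ℕ) (U : Fin n → Finset α),
    (∀ i, U i ⊆ Pset p r ∧ (S ∩ U i).Nonempty) →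
    0 < ∑ I ∈ (univ : Finset (Fin n)).powerset,
      (-1 : ℝ) ^ (n - I.card) * p r r (S \ I.biUnion U)

/-- Reference-independent CRA representation of a family of attention rules. -/
def RefIndepCRA (μ : α → Finset α → Finset α → ℝ) : Prop :=
  ∃ π : Finset α → ℝ, π ∅ = 0 ∧ (∀ D : Finset α, D.Nonempty → 0 < π D) ∧
    (∑ D ∈ (univ : Finset α).powerset, π D = 1) ∧
    ∀ r (S : Finset α), S.Nonempty → r ∈ S → ∀ D : Finset α, r ∈ D → D ⊆ S →
      μ r D S = ∑ D' ∈ (univ : Finset α).powerset.filter (fun D' => D' ∩ S = D),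
        (π D' + π (D'.erase r))

/-- The monotonicity property of Cattaneo et al. (2020). -/
def MonotonicAttention (r : α) (μ : Finset α → Finset α → ℝ) : Prop :=
  ∀ D S T : Finset α, r ∈ D → D ⊆ S → S ⊆ T → μ D T ≤ μ D S

/-- `(R, γ)` is an IRA representation of `p` (directly, in terms of attention maps). -/
def IsIRAPair (p : α → α → Finset α → ℝ) (R : α → α → Prop) (γ : α → α → ℝ) : Prop :=
  LinOrd R ∧ (∀ r, γ r r = 1 ∧ ∀ x, x ≠ r → 0 < γ r x ∧ γ r x < 1) ∧
    ∀ r (S : Finset α), S.Nonempty → r ∈ S → ∀ x ∈ S,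
      p r x S = ∑ D ∈ S.powerset.filter (fun D => r ∈ D ∧ IsMaxOf R x D),
        ((∏ a ∈ D, γ r a) * ∏ b ∈ S \ D, (1 - γ r b))

section Uniqueness

variable {p : α → α → Finset α → ℝ} {R : α → α → Prop} {μ : α → Finset α → Finset α → ℝ}

lemma LinOrd.refl (hR : LinOrd R) (x : α) : R x x := (hR.total x x).elim id id

lemma LinOrd.exists_isMaxOf (hR : LinOrd R) {S : Finset α} (hS : S.Nonempty) :
    ∃ x, IsMaxOf R x S := by
  induction hS using Finset.Nonempty.cons_induction with
  | singleton a => exact ⟨a, by simp [IsMaxOf, hR.refl]⟩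
  | cons a S ha hS ih =>
    obtain ⟨x, hx, hmax⟩ := ih
    rcases hR.total a x with h | h
    · refine ⟨a, by simp, fun y hy => ?_⟩
      rcases Finset.mem_cons.1 hy with rfl | hy
      · exact hR.refl _
      · exact hR.trans _ _ _ h (hmax y hy)
    · refine ⟨x, by simp [hx], fun y hy => ?_⟩
      rcases Finset.mem_cons.1 hy with rfl | hy
      · exact h
      · exact hmax y hy

/-- On a binary menu, a better alternative is chosen exactly when it is considered. -/
lemma IsRDRAMRep.apply_pair (h : IsRDRAMRep p R μ) {r x : α} (hx : R x r) :
    p r x {r, x} = μ r {r, x} {r, x} := by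
  rw [h.2.2 r {r, x} (by simp) (by simp) x (by simp)]
  have : ({r, x} : Finset α).powerset.filter (fun D => r ∈ D ∧ IsMaxOf R x D) = {{r, x}} := by
    ext D
    simp only [mem_filter, mem_powerset, mem_singleton]
    constructor
    · rintro ⟨hD, hr, hxD, -⟩
      exact hD.antisymm (by simp [insert_subset_iff, hr, hxD])
    · rintro rfl
      exact ⟨subset_rfl, by simp, by simp, by simp [hx, h.1.refl]⟩
  rw [this, sum_singleton]

lemma IsRDRAMRep.apply_pair_pos_iff (h : IsRDRAMRep p R μ) {r x : α} :
    0 < p r x {r, x} ↔ R x r := by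
  refine ⟨fun hpos => ?_, fun hx => ?_⟩
  · by_contra hx
    rw [h.2.2 r {r, x} (by simp) (by simp) x (by simp), filter_false_of_mem] at hpos
    · simp at hpos
    · rintro D - ⟨hr, -, hmax⟩
      exact hx (hmax r hr)
  · rw [h.apply_pair hx]
    exact (h.2.1 r).2 _ _ (by simp) (by simp) (by simp) subset_rfl

/-- The preference of an RD-RAM representation is unique. -/
lemma IsRDRAMRep.order_unique {R' : α → α → Prop} {μ' : α → Finset α → Finset α → ℝ}
    (h : IsRDRAMRep p R μ) (h' : IsRDRAMRep p R' μ') : R = R' := by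
  funext x r
  rw [← h.apply_pair_pos_iff, ← h'.apply_pair_pos_iff]

lemma IsRDRAMRep.apply_pair_lt_one (h : IsRDRAMRep p R μ) {r x : α} (hne : x ≠ r)
    (hx : R x r) : p r x {r, x} < 1 := by
  have hμ := h.2.1 r
  rw [h.apply_pair hx, ← hμ.1.sum_one {r, x} (by simp) (by simp)]
  refine Finset.single_lt_sum (f := fun D => μ r D {r, x}) (i := {r, x}) (j := {r}) ?_ (by simp) (by simp) ?_ fun D _ _ => hμ.1.nonneg _ _
  · intro heq
    exact hne (by simpa using heq.symm.subset (by simp : x ∈ ({r, x} : Finset α)))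
  · exact hμ.2 _ _ (by simp) (by simp) (by simp) (by simp)

/-- When the reference is the best alternative, nothing else is chosen. -/
lemma IsRDRAMRep.apply_of_reference_max (h : IsRDRAMRep p R μ) {r y : α} {S : Finset α}
    (hr : IsMaxOf R r S) (hy : y ∈ S) : p r y S = if y = r then 1 else 0 := by
  have hμ := (h.2.1 r).1
  rw [h.2.2 r S ⟨r, hr.1⟩ hr.1 y hy]
  split_ifs with hyr
  · subst hyr
    rw [← hμ.sum_one S ⟨y, hr.1⟩ hr.1]
    refine sum_subset (filter_subset _ _) fun D hD hD' => ?_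
    refine le_antisymm (not_lt.1 fun hpos => hD' ?_) (hμ.nonneg _ _)
    have hyD := (hμ.support S D ⟨y, hr.1⟩ hr.1 hpos).1
    exact mem_filter.2 ⟨hD, hyD, hyD, fun z hz => hr.2 z (mem_powerset.1 hD hz)⟩
  · rw [filter_false_of_mem, sum_empty]
    rintro D - ⟨hrD, -, hmax⟩
    exact hyr (h.1.antisymm _ _ (hmax r hrD) (hr.2 y hy))

/-- Under Luce attention, deleting the best alternative rescales all other choice
probabilities by the probability that it is not chosen. -/
lemma IsRDRAMRep.apply_eq_erase_mul_of_lra (h : IsRDRAMRep p R μ) {r x y : α}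
    (hL : HasLRA r (μ r)) {S : Finset α} (hr : r ∈ S) (hx : IsMaxOf R x S) (hxr : x ≠ r)
    (hy : y ∈ S) (hyx : y ≠ x) :
    p r y S = p r y (S.erase x) * (1 - p r x S) := by
  obtain ⟨π, hpos, -, hπ⟩ := hL
  set w : Finset α → ℝ := fun T => ∑ D ∈ T.powerset.filter (fun D => r ∈ D), π D with hw
  set a : α → Finset α → ℝ := fun z T =>
    ∑ D ∈ T.powerset.filter (fun D => r ∈ D ∧ IsMaxOf R z D), π D with ha
  have hwpos : ∀ T : Finset α, r ∈ T → 0 < w T := fun T hT =>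
    sum_pos (fun D hD => hpos D (mem_filter.1 hD).2) ⟨T, by simp [hT]⟩
  have hp : ∀ T : Finset α, r ∈ T → ∀ z ∈ T, p r z T = a z T / w T := by
    intro T hT z hz
    rw [h.2.2 r T ⟨r, hT⟩ hT z hz, ha, sum_div]
    refine sum_congr rfl fun D hD => ?_
    simp only [mem_filter, mem_powerset] at hD
    exact hπ T ⟨r, hT⟩ hT D hD.2.1 hD.1
  have hr' : r ∈ S.erase x := mem_erase.2 ⟨hxr.symm, hr⟩
  have hay : a y S = a y (S.erase x) := by
    refine sum_congr (Finset.ext fun D => ?_) fun _ _ => rfl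
    simp only [mem_filter, mem_powerset, subset_erase]
    refine ⟨fun hD => ⟨⟨hD.1, fun hxD => ?_⟩, hD.2⟩, fun hD => ⟨hD.1.1, hD.2⟩⟩
    exact hyx (h.1.antisymm _ _ (hD.2.2.2 x hxD) (hx.2 y hy))
  have hax : a x S + w (S.erase x) = w S := by
    simp only [hw, ha]
    rw [← sum_filter_add_sum_filter_not (S.powerset.filter (fun D => r ∈ D)) (fun D => x ∈ D)]
    congr 1
    · refine sum_congr (Finset.ext fun D => ?_) fun _ _ => rfl
      simp only [mem_filter, mem_powerset]
      exact ⟨fun hD => ⟨⟨hD.1, hD.2.1⟩, hD.2.2.1⟩,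
        fun hD => ⟨hD.1.1, hD.1.2, hD.2, fun z hz => hx.2 z (hD.1.1 hz)⟩⟩
    · refine sum_congr (Finset.ext fun D => ?_) fun _ _ => rfl
      simp only [mem_filter, mem_powerset, subset_erase]
      tauto
  have h1 := (hwpos S hr).ne'
  have h2 := (hwpos _ hr').ne'
  rw [hp S hr y hy, hp S hr x hx.1, hp _ hr' y (mem_erase.2 ⟨hyx, hy⟩), hay]
  rw [← hax] at h1 ⊢
  field_simp
  ring

/-- Under constant attention, the best alternative of a menu is chosen with the
same probability as from the binary menu. -/
lemma IsRDRAMRep.apply_max_eq_pair_of_cra (h : IsRDRAMRep p R μ) {r x : α}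
    (hC : HasCRA r (μ r)) {S : Finset α} (hr : r ∈ S) (hx : IsMaxOf R x S) :
    p r x S = p r x {r, x} := by
  obtain ⟨π, -, -, hπ⟩ := hC
  have key : ∀ T : Finset α, r ∈ T → IsMaxOf R x T →
      p r x T = ∑ D ∈ (univ : Finset (Finset α)).filter (fun D => r ∈ D ∧ x ∈ D), π D := by
    intro T hT hxT
    rw [h.2.2 r T ⟨r, hT⟩ hT x hxT.1]
    refine Eq.trans ?_ (sum_fiberwise_of_maps_to (g := fun D => D ∩ T)
      (t := T.powerset.filter (fun D => r ∈ D ∧ IsMaxOf R x D)) ?_ _)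
    · refine sum_congr rfl fun D hD => ?_
      simp only [mem_filter, mem_powerset] at hD
      rw [hπ T ⟨r, hT⟩ hT D hD.2.1 hD.1]
      refine sum_congr (Finset.ext fun D' => ?_) fun _ _ => rfl
      simp only [mem_filter, mem_powerset, subset_univ, mem_univ, true_and]
      refine ⟨fun hD' => ⟨⟨?_, ?_⟩, hD'⟩, fun hD' => hD'.2⟩
      · exact (mem_inter.1 (hD' ▸ hD.2.1)).1
      · exact (mem_inter.1 (hD' ▸ hD.2.2.1)).1
    · intro D hD
      simp only [mem_filter, mem_univ, true_and] at hD
      simp only [mem_filter, mem_powerset, mem_inter, inter_subset_right, true_and]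
      exact ⟨⟨hD.1, hT⟩, mem_inter.2 ⟨hD.2, hxT.1⟩, fun y hy => hxT.2 y (mem_inter.1 hy).2⟩
  rw [key S hr hx, key {r, x} (by simp) ⟨by simp, by simp [hx.2 r hr, h.1.refl]⟩]

/-- Two rules that are both Luce and constant for a common preference coincide once they
agree on binary menus. -/
lemma choice_eq_of_pair_eq {q : α → α → Finset α → ℝ}
    {μ₁ μ₂ ν₁ ν₂ : α → Finset α → Finset α → ℝ}
    (hp₁ : IsRDRAMRep p R μ₁) (hL : ∀ r, HasLRA r (μ₁ r))
    (hp₂ : IsRDRAMRep p R μ₂) (hC : ∀ r, HasCRA r (μ₂ r))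
    (hq₁ : IsRDRAMRep q R ν₁) (hL' : ∀ r, HasLRA r (ν₁ r))
    (hq₂ : IsRDRAMRep q R ν₂) (hC' : ∀ r, HasCRA r (ν₂ r))
    (hpair : ∀ r x, x ≠ r → R x r → p r x {r, x} = q r x {r, x})
    (r : α) (S : Finset α) (hr : r ∈ S) : ∀ y ∈ S, p r y S = q r y S := by
  induction S using Finset.strongInduction with
  | H S ih =>
    intro y hy
    obtain ⟨x, hx⟩ := hp₁.1.exists_isMaxOf ⟨r, hr⟩
    by_cases hxr : x = r
    · subst hxr
      rw [hp₁.apply_of_reference_max hx hy, hq₁.apply_of_reference_max hx hy]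
    have hpx : p r x S = q r x S := by
      rw [hp₂.apply_max_eq_pair_of_cra (hC r) hr hx, hq₂.apply_max_eq_pair_of_cra (hC' r) hr hx,
        hpair r x hxr (hx.2 r hr)]
    by_cases hyx : y = x
    · rw [hyx, hpx]
    · rw [hp₁.apply_eq_erase_mul_of_lra (hL r) hr hx hxr hy hyx,
        hq₁.apply_eq_erase_mul_of_lra (hL' r) hr hx hxr hy hyx, hpx,
        ih _ (erase_ssubset hx.1) (mem_erase.2 ⟨Ne.symm hxr, hr⟩) y (mem_erase.2 ⟨hyx, hy⟩)]

end Uniqueness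

section IndependentAttention

/-- Probability that independent attention with parameters `γ` on the menu `S` yields `D`. -/
def indepWeight (γ : α → ℝ) (D S : Finset α) : ℝ := (∏ x ∈ D, γ x) * ∏ y ∈ S \ D, (1 - γ y)

lemma sum_indepWeight (γ : α → ℝ) (S : Finset α) :
    ∑ D ∈ S.powerset, indepWeight γ D S = 1 := by
  have := Finset.prod_add γ (fun y => 1 - γ y) S
  simpa [indepWeight] using this.symm

lemma indepWeight_union (γ : α → ℝ) {D S E T : Finset α} (hST : Disjoint S T) (hD : D ⊆ S)
    (hE : E ⊆ T) :
    indepWeight γ (D ∪ E) (S ∪ T) = indepWeight γ D S * indepWeight γ E T := by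
  have hsd : (S ∪ T) \ (D ∪ E) = (S \ D) ∪ (T \ E) := by
    ext z
    have : z ∈ S → z ∉ T := fun hz => Finset.disjoint_left.1 hST hz
    have := @hD z
    have := @hE z
    simp only [mem_sdiff, mem_union]
    tauto
  rw [indepWeight, hsd, prod_union (hST.mono hD hE),
    prod_union (hST.mono sdiff_subset sdiff_subset), indepWeight, indepWeight]
  ring

variable {γ : α → ℝ} {r : α}

lemma indepWeight_nonneg (h0 : ∀ x, 0 ≤ γ x) (h1 : ∀ x, γ x ≤ 1) (D S : Finset α) :
    0 ≤ indepWeight γ D S :=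
  mul_nonneg (prod_nonneg fun x _ => h0 x) (prod_nonneg fun x _ => sub_nonneg.2 (h1 x))

lemma indepWeight_eq_zero (hr : γ r = 1) {D S : Finset α} (hS : r ∈ S) (hD : r ∉ D) :
    indepWeight γ D S = 0 := by
  rw [indepWeight, prod_eq_zero (mem_sdiff.2 ⟨hS, hD⟩) (by simp [hr]), mul_zero]

lemma indepWeight_pos (hr : γ r = 1) (hγ : ∀ x, x ≠ r → 0 < γ x ∧ γ x < 1)
    {D S : Finset α} (hD : r ∉ S \ D) : 0 < indepWeight γ D S := by
  refine mul_pos (prod_pos fun x _ => ?_) (prod_pos fun x hx => ?_)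
  · by_cases hx : x = r
    · simp [hx, hr]
    · exact (hγ x hx).1
  · exact sub_pos.2 (hγ x (ne_of_mem_of_not_mem hx hD)).2

lemma sum_filter_indepWeight (hr : γ r = 1) {S : Finset α} (hS : r ∈ S) :
    ∑ D ∈ S.powerset.filter (fun D => r ∈ D), indepWeight γ D S = 1 := by
  rw [← sum_indepWeight γ S]
  refine sum_subset (filter_subset _ _) fun D hD hD' => indepWeight_eq_zero hr hS fun h => ?_
  exact hD' (mem_filter.2 ⟨hD, h⟩)

variable {μ : Finset α → Finset α → ℝ}

lemma HasIRA.hasLRA (h : HasIRA r μ) : HasLRA r μ := by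
  obtain ⟨γ, hr, hγ, hμ⟩ := h
  refine ⟨fun D => indepWeight γ D univ, fun D hD => indepWeight_pos hr hγ (by simp [hD]),
    sum_filter_indepWeight hr (mem_univ r), fun S hS hrS D hrD hD => ?_⟩
  have hfactor : ∀ E ⊆ S,
      indepWeight γ E univ = indepWeight γ E S * indepWeight γ ∅ Sᶜ := fun E hE => by
    rw [← indepWeight_union γ disjoint_compl_right hE (empty_subset _), union_empty,
      union_compl]
  have hsum : ∑ E ∈ S.powerset.filter (fun E => r ∈ E), indepWeight γ E univ =
      indepWeight γ ∅ Sᶜ := by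
    rw [sum_congr rfl fun E hE => hfactor E (mem_powerset.1 (mem_filter.1 hE).1), ← sum_mul,
      sum_filter_indepWeight hr hrS, one_mul]
  have hpos : 0 < indepWeight γ ∅ Sᶜ := indepWeight_pos hr hγ (by simp [hrS])
  dsimp only
  rw [hsum, hfactor D hD, mul_div_cancel_right₀ _ hpos.ne']
  exact hμ S hS hrS D hrD hD

lemma HasIRA.hasCRA (h : HasIRA r μ) : HasCRA r μ := by
  obtain ⟨γ, hr, hγ, hμ⟩ := h
  refine ⟨fun D => indepWeight γ D univ, fun D hD => indepWeight_pos hr hγ (by simp [hD]),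
    sum_filter_indepWeight hr (mem_univ r), fun S hS hrS D hrD hD => ?_⟩
  have hsum : ∑ D' ∈ (univ : Finset α).powerset.filter (fun D' => D' ∩ S = D),
      indepWeight γ D' univ = ∑ E ∈ Sᶜ.powerset, indepWeight γ D S * indepWeight γ E Sᶜ := by
    refine sum_nbij' (fun D' => D' \ S) (fun E => D ∪ E) ?_ ?_ ?_ ?_ ?_
    · intro D' _
      simp [subset_iff]
    · intro E hE
      have hE' : E ∩ S = ∅ :=
        disjoint_iff_inter_eq_empty.1 (disjoint_compl_left.mono_left (mem_powerset.1 hE))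
      simp [union_inter_distrib_right, hE', inter_eq_left.2 hD]
    · intro D' hD'
      rw [← (mem_filter.1 hD').2, union_comm, sdiff_union_inter]
    · intro E hE
      have hE' : Disjoint E S := disjoint_compl_left.mono_left (mem_powerset.1 hE)
      simp [union_sdiff_distrib, sdiff_eq_empty_iff_subset.2 hD, hE'.sdiff_eq_left]
    · intro D' hD'
      have hsub : D' \ S ⊆ Sᶜ := by simp [subset_iff]
      rw [← indepWeight_union γ disjoint_compl_right hD hsub, union_compl,
        ← (mem_filter.1 hD').2, union_comm, sdiff_union_inter]
  rw [hsum, ← mul_sum, sum_indepWeight, mul_one]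
  exact hμ S hS hrS D hrD hD

/-- The attention rule generated by independent attention parameters. -/
def indepAttention (γ : α → ℝ) (D S : Finset α) : ℝ := if D ⊆ S then indepWeight γ D S else 0

lemma isAttentionRule_indepAttention (hr : γ r = 1) (hγ : ∀ x, x ≠ r → 0 < γ x ∧ γ x < 1) :
    IsAttentionRule r (indepAttention γ) := by
  have hbd : ∀ x, 0 ≤ γ x ∧ γ x ≤ 1 := fun x => by
    by_cases hx : x = r
    · simp [hx, hr]
    · exact ⟨(hγ x hx).1.le, (hγ x hx).2.le⟩
  refine ⟨fun D S => ?_, fun S D _ hrS hpos => ?_, fun S _ _ => ?_⟩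
  · unfold indepAttention
    split_ifs
    · exact indepWeight_nonneg (fun x => (hbd x).1) (fun x => (hbd x).2) D S
    · exact le_rfl
  · unfold indepAttention at hpos
    split_ifs at hpos with hD
    · refine ⟨by_contra fun hrD => ?_, hD⟩
      exact hpos.ne' (indepWeight_eq_zero hr hrS hrD)
    · exact absurd hpos (lt_irrefl 0)
  · rw [← sum_indepWeight γ S]
    exact sum_congr rfl fun D hD => if_pos (mem_powerset.1 hD)

lemma fullSupport_indepAttention (hr : γ r = 1) (hγ : ∀ x, x ≠ r → 0 < γ x ∧ γ x < 1) :
    FullSupport r (indepAttention γ) := fun S D _ _ hrD hD => by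
  rw [indepAttention, if_pos hD]
  exact indepWeight_pos hr hγ (by simp [hrD])

lemma hasIRA_indepAttention (hr : γ r = 1) (hγ : ∀ x, x ≠ r → 0 < γ x ∧ γ x < 1) :
    HasIRA r (indepAttention γ) :=
  ⟨γ, hr, hγ, fun _ _ _ _ _ hD => if_pos hD⟩

end IndependentAttention

lemma hasIRARep_of_hasLRARep_of_hasCRARep {p : α → α → Finset α → ℝ}
    (hL : HasLRARep p) (hC : HasCRARep p) : HasIRARep p := by
  obtain ⟨R, μ, h, hL⟩ := hL
  obtain ⟨R', ν, h', hC⟩ := hC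
  obtain rfl := h.order_unique h'
  let γ : α → α → ℝ := fun r x => if x = r then 1 else if R x r then p r x {r, x} else 1 / 2
  have hr : ∀ r, γ r r = 1 := fun r => if_pos rfl
  have hγ : ∀ r x, x ≠ r → 0 < γ r x ∧ γ r x < 1 := by
    intro r x hx
    simp only [γ, if_neg hx]
    split_ifs with hxr
    · exact ⟨h.apply_pair_pos_iff.2 hxr, h.apply_pair_lt_one hx hxr⟩
    · norm_num
  let ξ : α → Finset α → Finset α → ℝ := fun r => indepAttention (γ r)
  let q : α → α → Finset α → ℝ := fun r x S =>
    ∑ D ∈ S.powerset.filter (fun D => r ∈ D ∧ IsMaxOf R x D), ξ r D S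
  have hξ : ∀ r, IsAttentionRule r (ξ r) ∧ FullSupport r (ξ r) := fun r =>
    ⟨isAttentionRule_indepAttention (hr r) (hγ r), fullSupport_indepAttention (hr r) (hγ r)⟩
  have hI : ∀ r, HasIRA r (ξ r) := fun r => hasIRA_indepAttention (hr r) (hγ r)
  have hq : IsRDRAMRep q R ξ := ⟨h.1, hξ, fun _ _ _ _ _ _ => rfl⟩
  refine ⟨R, ξ, ⟨h.1, hξ, fun r S _ hrS x hx => ?_⟩, hI⟩
  refine choice_eq_of_pair_eq h hL h' hC hq (fun r => (hI r).hasLRA) hq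
    (fun r => (hI r).hasCRA) (fun r x hne hxr => ?_) r S hrS x hx
  rw [hq.apply_pair hxr]
  simp [ξ, indepAttention, indepWeight, prod_pair hne.symm, γ, hne, hxr]

/-- a reference-dependent random choice rule has an IRA
representation iff it has both LRA and CRA representations. -/
theorem rule_ira_iff_lra_and_cra (h2 : 2 ≤ Fintype.card α)
    (p : α → α → Finset α → ℝ) (hp : IsRandomChoiceRule p) :
    HasIRARep p ↔ HasLRARep p ∧ HasCRARep p := by
  refine ⟨?_, fun h => hasIRARep_of_hasLRARep_of_hasCRARep h.1 h.2⟩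
  rintro ⟨R, μ, h, hI⟩
  exact ⟨⟨R, μ, h, fun r => (hI r).hasLRA⟩, ⟨R, μ, h, fun r => (hI r).hasCRA⟩⟩

end
end RDRAM
end

section
/- Suppose the reference-dependent random choice rule {p_r}_{r∈X} has an RD-RAM representation and satisfies IDA and RIDA. Then for every menu S with r ∈ S, every x ∈ S∖{r} with p_x(x,S) = 1, and every y ∈ S∖{x}: p_r(y,S) = p_r(y,S∖{x}) · p_r(r,{x,r}). -/
open Finset
open scoped Classical

namespace RDRAM

noncomputable section

variable {α : Type*} [Fintype α] [DecidableEq α]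

/-- In an RD-RAM representation, `y` is chosen with positive probability at reference `r`
exactly when it is weakly preferred to `r`. -/
theorem IsRDRAMRep.pos_iff {p : α → α → Finset α → ℝ} {R : α → α → Prop}
    {μ : α → Finset α → Finset α → ℝ} (h : IsRDRAMRep p R μ) {r y : α} {S : Finset α}
    (hr : r ∈ S) (hy : y ∈ S) : 0 < p r y S ↔ R y r := by
  obtain ⟨hR, hμ, hp⟩ := h
  rw [hp r S ⟨r, hr⟩ hr y hy]
  constructor
  · intro hpos
    obtain ⟨D, hD, -⟩ := Finset.exists_ne_zero_of_sum_ne_zero hpos.ne'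
    have hD' := (Finset.mem_filter.mp hD).2
    exact hD'.2.2 r hD'.1
  · intro hyr
    have hsub : ({r, y} : Finset α) ⊆ S := by simp [Finset.insert_subset_iff, hr, hy]
    have hmem : ({r, y} : Finset α) ∈
        S.powerset.filter (fun D => r ∈ D ∧ IsMaxOf R y D) := by
      have hyy : R y y := (hR.total y y).elim id id
      refine Finset.mem_filter.mpr ⟨Finset.mem_powerset.mpr hsub, by simp, by simp, ?_⟩
      simp [hyr, hyy]
    exact lt_of_lt_of_le ((hμ r).2 S {r, y} ⟨r, hr⟩ hr (by simp) hsub)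
      (Finset.single_le_sum (f := fun D => μ r D S)
        (fun D _ => (hμ r).1.nonneg D S) hmem)

/-- An alternative that is surely chosen when it is the reference is preferred to
everything in the menu. -/
theorem IsRDRAMRep.rel_of_eq_one {p : α → α → Finset α → ℝ} {R : α → α → Prop}
    {μ : α → Finset α → Finset α → ℝ} (h : IsRDRAMRep p R μ)
    (hp : IsRandomChoiceRule p) {x y : α} {S : Finset α}
    (hx : x ∈ S) (hx1 : p x x S = 1) (hy : y ∈ S) : R x y := by
  rcases h.1.total x y with hxy | hyx
  · exact hxy
  · have hpos := (h.pos_iff hx hy).mpr hyx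
    by_cases hne : y = x
    · subst hne; exact hyx
    · have hsum := hp.sum_one x S ⟨x, hx⟩ hx
      rw [← Finset.add_sum_erase S _ hx] at hsum
      have := Finset.single_le_sum (f := fun z => p x z S)
        (fun z _ => hp.nonneg x z S) (Finset.mem_erase.mpr ⟨hne, hy⟩)
      linarith

/-- Under IDA, the choice probability of the best alternative in a menu depends only on
that alternative and the reference. -/
theorem IsRDRAMRep.eq_pair_of_isMaxOf {p : α → α → Finset α → ℝ} {R : α → α → Prop}
    {μ : α → Finset α → Finset α → ℝ} (h : IsRDRAMRep p R μ) (hida : IDA p) {r x : α}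
    (S : Finset α) (hr : r ∈ S) (hmax : IsMaxOf R x S) : p r x S = p r x {x, r} := by
  induction S using Finset.strongInduction with
  | H S ih =>
    obtain ⟨hx, hmax⟩ := hmax
    by_cases hS : S ⊆ {x, r}
    · congr 1
      exact hS.antisymm (by simp [Finset.insert_subset_iff, hr, hx])
    · obtain ⟨y, hyS, hy⟩ := Finset.not_subset.mp hS
      simp only [Finset.mem_insert, Finset.mem_singleton, not_or] at hy
      rw [hida r S ⟨r, hr⟩ hr x hx y hyS hy.2 hy.1
        ⟨S, hx, hyS, (h.pos_iff hyS hx).mpr (hmax y hyS)⟩]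
      exact ih _ (Finset.erase_ssubset hyS)
        (Finset.mem_erase.mpr ⟨Ne.symm hy.2, hr⟩)
        ⟨Finset.mem_erase.mpr ⟨Ne.symm hy.1, hx⟩,
          fun z hz => hmax z (Finset.mem_of_mem_erase hz)⟩

/-- under IDA and RIDA, removing the dominant alternative rescales
choice probabilities by `p_r(r,{x,r})`. -/
theorem dominant_removal (h2 : 2 ≤ Fintype.card α)
    (p : α → α → Finset α → ℝ) (hp : IsRandomChoiceRule p)
    (hrd : ∃ (R : α → α → Prop) (μ : α → Finset α → Finset α → ℝ), IsRDRAMRep p R μ)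
    (hida : IDA p) (hrida : RIDA p) :
    ∀ (S : Finset α), S.Nonempty → ∀ r ∈ S, ∀ x ∈ S, x ≠ r → p x x S = 1 →
      ∀ y ∈ S, y ≠ x → p r y S = p r y (S.erase x) * p r r ({x, r} : Finset α) := by
  obtain ⟨R, μ, h⟩ := hrd
  intro S hS r hr x hx hxr hx1 y hy hyx
  have hmax : IsMaxOf R x S := ⟨hx, fun z hz => h.rel_of_eq_one hp hx hx1 hz⟩
  have hrE : r ∈ S.erase x := Finset.mem_erase.mpr ⟨hxr.symm, hr⟩
  have hrr : R r r := (h.1.total r r).elim id id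
  have hS0 : 0 < p r r S := (h.pos_iff hr hr).mpr hrr
  have hE0 : 0 < p r r (S.erase x) := (h.pos_iff hrE hrE).mpr hrr
  have hprop : ∀ z ∈ S.erase x,
      p r z S = p r z (S.erase x) * (p r r S / p r r (S.erase x)) := by
    intro z hz
    obtain ⟨hzx, hzS⟩ := Finset.mem_erase.mp hz
    by_cases hzr : R z r
    · have hz0 := (h.pos_iff hr hzS).mpr hzr
      have hratio := hrida r S hS hr x hx hxr z hzS hzx r hr hxr.symm hx1
        (mul_pos hz0 hS0)
      field_simp at hratio ⊢
      linarith
    · have hzS0 : p r z S = 0 := le_antisymm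
        (not_lt.mp fun hpos => hzr ((h.pos_iff hr hzS).mp hpos)) (hp.nonneg _ _ _)
      have hzE0 : p r z (S.erase x) = 0 := le_antisymm
        (not_lt.mp fun hpos => hzr ((h.pos_iff hrE hz).mp hpos)) (hp.nonneg _ _ _)
      rw [hzS0, hzE0, zero_mul]
  have hscale : p r r S / p r r (S.erase x) = p r r {x, r} := by
    have hsum := hp.sum_one r S hS hr
    rw [← Finset.add_sum_erase S _ hx, Finset.sum_congr rfl hprop, ← Finset.sum_mul,
      hp.sum_one r _ ⟨r, hrE⟩ hrE, h.eq_pair_of_isMaxOf hida S hr hmax] at hsum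
    have hpair := hp.sum_one r {x, r} ⟨r, by simp⟩ (by simp)
    rw [Finset.sum_pair hxr] at hpair
    linarith
  rw [hprop y (Finset.mem_erase.mpr ⟨hyx, hy⟩), hscale]

end
end RDRAM
end
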